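/- arXiv:1802.08952 — 3 statements merged into one kernel-verified Lean document; each statement's English description precedes it below -/
import Mathlib

section
/- (g-formula.) Under (A1) consistency Y = Y^Z almost surely, (A2) Z-positivity ε < ℙ(Z=z ∣ X) < 1−ε almost surely for some ε > 0, and (A3) Z-exchangeability Z ⊥⊥ Y^z ∣ X, the mean potential outcome is identified as 𝔼(Y^z) = 𝔼[ 𝔼(Y ∣ X, Z=z) ], i.e. the expectation over the marginal distribution of X of the outcome regression 𝔼(Y ∣ X=x, Z=z). -/
open MeasureTheory ProbabilityTheory MeasurableSpace

/-- The conditional expectation of a product of conditionally independent real random variables is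
the product of their conditional expectations. -/
theorem ProbabilityTheory.CondIndepFun.condExp_mul_ae_eq
    {Ω : Type*} {m' mΩ : MeasurableSpace Ω} [StandardBorelSpace Ω] {hm' : m' ≤ mΩ}
    {μ : Measure Ω} [IsFiniteMeasure μ] {f g : Ω → ℝ}
    (h : CondIndepFun m' hm' f g μ) (hf : Measurable f) (hg : Measurable g)
    (hfint : Integrable f μ) (hgint : Integrable g μ) (hfgint : Integrable (f * g) μ) :
    μ[f * g | m'] =ᵐ[μ] μ[f | m'] * μ[g | m'] := by
  have hker := ae_of_ae_trim hm' ((condIndepFun_iff_map_prod_eq_prod_map_map hf hg).1 h)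
  filter_upwards [hker, condExp_ae_eq_integral_condExpKernel hm' hfint,
    condExp_ae_eq_integral_condExpKernel hm' hgint,
    condExp_ae_eq_integral_condExpKernel hm' hfgint] with ω hω hωf hωg hωfg
  rw [Kernel.map_apply _ (hf.prodMk hg), Kernel.prod_apply, Kernel.map_apply _ hf,
    Kernel.map_apply _ hg] at hω
  have hne : Nonempty Ω := ⟨ω⟩
  have hindep : IndepFun f g (condExpKernel μ m' ω) :=
    (indepFun_iff_map_prod_eq_prod_map_map hf.aemeasurable hg.aemeasurable).2 hω
  rw [Pi.mul_apply, hωf, hωg, hωfg]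
  exact hindep.integral_mul_eq_mul_integral hf.aestronglyMeasurable hg.aestronglyMeasurable

/-- **g-formula.**
Under (A1) consistency `Y = Y^Z` a.s. (here: `Y = Y^z` a.s. on `{Z = z}`),
(A2) Z-positivity `ε < ℙ(Z=z ∣ X) < 1−ε` a.s., and (A3) Z-exchangeability `Z ⊥⊥ Y^z ∣ X`,
the mean potential outcome is identified as `𝔼(Y^z) = 𝔼[ 𝔼(Y ∣ X, Z=z) ]`,
where `m(x, z')` is a version of the outcome regression `𝔼(Y ∣ X=x, Z=z')`. -/
theorem g_formula
    {Ω : Type*} [MeasurableSpace Ω] [StandardBorelSpace Ω] [Nonempty Ω]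
    {𝒵 : Type*} [MeasurableSpace 𝒵] [MeasurableSingletonClass 𝒵] [Finite 𝒵] [DecidableEq 𝒵]
    {d p : ℕ}
    (μ : Measure Ω) [IsProbabilityMeasure μ]
    (X : Ω → (Fin d → ℝ)) (Z : Ω → 𝒵) (Y : Ω → (Fin p → ℝ))
    (hX : Measurable X) (hZ : Measurable Z) (hY : Measurable Y)
    (hYint : ∀ j, Integrable (fun ω => Y ω j) μ)
    (z : 𝒵)
    -- potential outcome under treatment level z
    (Yz : Ω → (Fin p → ℝ)) (hYz : Measurable Yz)
    (hYzint : ∀ j, Integrable (fun ω => Yz ω j) μ)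
    -- (A1) consistency
    (hA1 : ∀ᵐ ω ∂μ, Z ω = z → Y ω = Yz ω)
    -- (A2) Z-positivity, with pz a version of ℙ(Z=z ∣ X)
    (pz : (Fin d → ℝ) → ℝ) (hpzm : Measurable pz)
    (hpz : (fun ω => pz (X ω)) =ᵐ[μ]
      μ[fun ω => if Z ω = z then (1 : ℝ) else 0 | MeasurableSpace.comap X inferInstance])
    (ε : ℝ) (hε : 0 < ε)
    (hA2 : ∀ᵐ ω ∂μ, ε < pz (X ω) ∧ pz (X ω) < 1 - ε)
    -- (A3) Z-exchangeability
    (hA3 : CondIndepFun (MeasurableSpace.comap X inferInstance) hX.comap_le Z Yz μ)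
    -- outcome regression: m(X, Z) is a version of 𝔼(Y ∣ X, Z)
    (m : (Fin d → ℝ) × 𝒵 → (Fin p → ℝ)) (hm : Measurable m)
    (hreg : ∀ j : Fin p, (fun ω => m (X ω, Z ω) j) =ᵐ[μ]
      μ[fun ω => Y ω j | MeasurableSpace.comap (fun ω => (X ω, Z ω)) inferInstance]) :
    ∀ j : Fin p, ∫ ω, Yz ω j ∂μ = ∫ ω, m (X ω, z) j ∂μ := by
  intro j
  have hXZ : Measurable (fun ω => (X ω, Z ω)) := hX.prodMk hZ
  have hX_le := hX.comap_le
  have hXZ_le := hXZ.comap_le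
  have hXZ_comap : Measurable[MeasurableSpace.comap (fun ω => (X ω, Z ω)) inferInstance]
      (fun ω => (X ω, Z ω)) :=
    comap_measurable _
  have hX_le_XZ : MeasurableSpace.comap X inferInstance ≤
      MeasurableSpace.comap (fun ω => (X ω, Z ω)) inferInstance :=
    (measurable_fst.comp hXZ_comap).comap_le
  let i : 𝒵 → ℝ := fun z' => if z' = z then 1 else 0
  have hi : Measurable i :=
    Measurable.ite (measurableSet_singleton z) measurable_const measurable_const
  let I : Ω → ℝ := fun ω => i (Z ω)
  have hI : Measurable I := hi.comp hZ
  have hI_comap : StronglyMeasurable[MeasurableSpace.comap (fun ω => (X ω, Z ω)) inferInstance] I :=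
    ((hi.comp measurable_snd).comp hXZ_comap).stronglyMeasurable
  have hIbound : ∀ ω, ‖I ω‖ ≤ 1 := by
    intro ω
    by_cases h : Z ω = z <;> simp [I, i, h]
  have hImul {f : Ω → ℝ} (hf : Integrable f μ) : Integrable (I * f) μ :=
    hf.bdd_mul hI.aestronglyMeasurable (ae_of_all _ hIbound)
  have hIint : Integrable I μ :=
    Integrable.of_bound hI.aestronglyMeasurable 1 (ae_of_all _ hIbound)
  let W : Ω → ℝ := fun ω => m (X ω, z) j
  have hW : StronglyMeasurable[MeasurableSpace.comap X inferInstance] W :=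
    (((measurable_pi_apply j).comp (hm.comp measurable_prodMk_right)).comp
      (comap_measurable X)).stronglyMeasurable
  have hWI : W * I =ᵐ[μ]
      μ[I * (fun ω => Y ω j) | MeasurableSpace.comap (fun ω => (X ω, Z ω)) inferInstance] := by
    filter_upwards [hreg j, condExp_mul_of_stronglyMeasurable_left hI_comap (hImul (hYint j))
      (hYint j)] with ω h1 h2
    rw [h2, Pi.mul_apply, Pi.mul_apply, ← h1]
    by_cases h : Z ω = z <;> simp [I, i, W, h]
  have hWIint : Integrable (W * I) μ := integrable_condExp.congr hWI.symm
  have hIY : I * (fun ω => Y ω j) =ᵐ[μ] I * (fun ω => Yz ω j) := by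
    filter_upwards [hA1] with ω h1
    by_cases h : Z ω = z
    · simp [h1 h]
    · simp [I, i, h]
  have hindep : CondIndepFun (MeasurableSpace.comap X inferInstance) hX_le I (fun ω => Yz ω j) μ :=
    hA3.comp hi (measurable_pi_apply j)
  have hkey : W =ᵐ[μ] μ[fun ω => Yz ω j | MeasurableSpace.comap X inferInstance] := by
    filter_upwards [condExp_mul_of_stronglyMeasurable_left hW hWIint hIint,
      condExp_congr_ae (m := MeasurableSpace.comap X inferInstance) hWI,
      condExp_condExp_of_le (μ := μ) (f := I * (fun ω => Y ω j)) hX_le_XZ hXZ_le,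
      condExp_congr_ae (m := MeasurableSpace.comap X inferInstance) hIY,
      hindep.condExp_mul_ae_eq hI ((measurable_pi_apply j).comp hYz) hIint (hYzint j)
        (hImul (hYzint j)), hpz, hA2] with ω h1 h2 h3 h4 h5 h6 h7
    have hpos : μ[I | MeasurableSpace.comap X inferInstance] ω ≠ 0 := by
      have : pz (X ω) = μ[I | MeasurableSpace.comap X inferInstance] ω := h6
      rw [← this]
      exact (hε.trans h7.1).ne'
    have h8 := h1.symm.trans (h2.trans (h3.trans (h4.trans h5)))
    rw [Pi.mul_apply, Pi.mul_apply, mul_comm] at h8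
    exact mul_left_cancel₀ hpos h8
  exact ((integral_congr_ae hkey).trans (integral_condExp hX_le)).symm
end

section
/- (Mean-zero property of the influence function.) If ε < π(X,Y) < 1−ε and ε < γ_z(X) < 1 almost surely for some ε > 0, then the uncentered efficient influence function satisfies 𝔼_P[ φ_z(O; P) ] = 𝔼_P[ β_z(X)/γ_z(X) ] = ψ_z(P), i.e. φ_z(O;P) − ψ_z(P) has mean zero under P. -/
open MeasureTheory ProbabilityTheory MeasurableSpace

/-- The uncentered (efficient) influence function `φ_z(o; P)`, componentwise in `j`, for an
observation `o = (x, r, z', y)` and nuisance functions `(π, λ_z, β_z, γ_z)`. -/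
noncomputable def phiFn {d p : ℕ} {𝒵 : Type*} [DecidableEq 𝒵] (z : 𝒵)
    (pi lam : (Fin d → ℝ) × (Fin p → ℝ) → ℝ)
    (beta : (Fin d → ℝ) → (Fin p → ℝ)) (gam : (Fin d → ℝ) → ℝ)
    (o : (Fin d → ℝ) × Bool × 𝒵 × (Fin p → ℝ)) (j : Fin p) : ℝ :=
  ((o.2.2.2 j - beta o.1 j / gam o.1) / gam o.1) *
      ((if o.2.1 then (1 : ℝ) else 0) *
          ((if o.2.2.1 = z then (1 : ℝ) else 0) - lam (o.1, o.2.2.2)) / pi (o.1, o.2.2.2)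
        + lam (o.1, o.2.2.2))
    + beta o.1 j / gam o.1

/-- Integrating a function of `T` against `g` is the same as integrating it against a version of
the conditional expectation of `g` given `T`. -/
theorem integral_comp_mul_eq_of_ae_eq_condExp {Ω E : Type*} [MeasurableSpace Ω]
    [MeasurableSpace E] {μ : Measure Ω} [IsFiniteMeasure μ] {T : Ω → E} (hT : Measurable T)
    {u : E → ℝ} (hu : Measurable u) {g h : Ω → ℝ} (hg : Integrable g μ)
    (hug : Integrable (fun x => u (T x) * g x) μ)
    (hh : h =ᵐ[μ] μ[g | MeasurableSpace.comap T inferInstance]) :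
    ∫ x, u (T x) * g x ∂μ = ∫ x, u (T x) * h x ∂μ := by
  have hf : StronglyMeasurable[MeasurableSpace.comap T inferInstance] (fun x => u (T x)) :=
    (hu.comp (comap_measurable T)).stronglyMeasurable
  rw [← integral_condExp hT.comap_le]
  refine integral_congr_ae ?_
  filter_upwards [condExp_mul_of_stronglyMeasurable_left hf hug hg, hh] with x hx hhx
  rw [hhx]
  exact hx

/-- **Mean-zero property of the influence function.**
If `ε < π(X,Y) < 1−ε` and `ε < γ_z(X) < 1` a.s., then
`𝔼_P[φ_z(O; P)] = 𝔼_P[β_z(X)/γ_z(X)] = ψ_z(P)` componentwise, i.e. the centered efficient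
influence function `φ_z(O;P) − ψ_z(P)` has mean zero under `P`. -/
theorem influence_function_mean_zero
    {𝒵 : Type*} [MeasurableSpace 𝒵] [MeasurableSingletonClass 𝒵] [Finite 𝒵] [DecidableEq 𝒵]
    {d p : ℕ} (z : 𝒵)
    (P : Measure ((Fin d → ℝ) × Bool × 𝒵 × (Fin p → ℝ))) [IsProbabilityMeasure P]
    (hYint : ∀ j : Fin p, Integrable (fun o => o.2.2.2 j) P)
    (pi : (Fin d → ℝ) × (Fin p → ℝ) → ℝ) (hpim : Measurable pi)
    (hpi : (fun o => pi (o.1, o.2.2.2)) =ᵐ[P]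
      P[fun o => if o.2.1 then (1 : ℝ) else 0 |
        MeasurableSpace.comap (fun o => (o.1, o.2.2.2)) inferInstance])
    (lam : (Fin d → ℝ) × (Fin p → ℝ) → ℝ) (hlamm : Measurable lam)
    (hlam : (fun o => lam (o.1, o.2.2.2) * pi (o.1, o.2.2.2)) =ᵐ[P]
      P[fun o => (if o.2.2.1 = z then (1 : ℝ) else 0) * (if o.2.1 then (1 : ℝ) else 0) |
        MeasurableSpace.comap (fun o => (o.1, o.2.2.2)) inferInstance])
    (beta : (Fin d → ℝ) → (Fin p → ℝ)) (hbetam : Measurable beta)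
    (hbeta : ∀ j : Fin p, (fun o => beta o.1 j) =ᵐ[P]
      P[fun o => o.2.2.2 j * lam (o.1, o.2.2.2) | MeasurableSpace.comap Prod.fst inferInstance])
    (gam : (Fin d → ℝ) → ℝ) (hgamm : Measurable gam)
    (hgam : (fun o => gam o.1) =ᵐ[P]
      P[fun o => lam (o.1, o.2.2.2) | MeasurableSpace.comap Prod.fst inferInstance])
    (ε : ℝ) (hε : 0 < ε)
    (hpib : ∀ᵐ o ∂P, ε < pi (o.1, o.2.2.2) ∧ pi (o.1, o.2.2.2) < 1 - ε)
    (hgamb : ∀ᵐ o ∂P, ε < gam o.1 ∧ gam o.1 < 1) :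
    ∀ j : Fin p, ∫ o, phiFn z pi lam beta gam o j ∂P = ∫ o, beta o.1 j / gam o.1 ∂P := by
  intro j
  have hTm : Measurable (fun o : (Fin d → ℝ) × Bool × 𝒵 × (Fin p → ℝ) => (o.1, o.2.2.2)) := by
    fun_prop
  have hXm : Measurable (Prod.fst : (Fin d → ℝ) × Bool × 𝒵 × (Fin p → ℝ) → (Fin d → ℝ)) :=
    measurable_fst
  have hRm : Measurable (fun o : (Fin d → ℝ) × Bool × 𝒵 × (Fin p → ℝ) =>
      if o.2.1 then (1 : ℝ) else 0) :=
    Measurable.ite ((measurableSet_singleton true).preimage (by fun_prop))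
      measurable_const measurable_const
  have hZm : Measurable (fun o : (Fin d → ℝ) × Bool × 𝒵 × (Fin p → ℝ) =>
      if o.2.2.1 = z then (1 : ℝ) else 0) :=
    Measurable.ite ((measurableSet_singleton z).preimage
        (f := fun o : (Fin d → ℝ) × Bool × 𝒵 × (Fin p → ℝ) => o.2.2.1) (by fun_prop))
      measurable_const measurable_const
  have hZRm := hZm.mul hRm
  have hRint : Integrable (fun o : (Fin d → ℝ) × Bool × 𝒵 × (Fin p → ℝ) =>
      if o.2.1 then (1 : ℝ) else 0) P :=
    .of_bound hRm.aestronglyMeasurable 1 (ae_of_all _ fun o => by split_ifs <;> simp)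
  have hZRbd : ∀ o : (Fin d → ℝ) × Bool × 𝒵 × (Fin p → ℝ),
      ‖(if o.2.2.1 = z then (1 : ℝ) else 0) * (if o.2.1 then (1 : ℝ) else 0)‖ ≤ 1 := fun o => by
    split_ifs <;> simp
  have hZRint : Integrable (fun o : (Fin d → ℝ) × Bool × 𝒵 × (Fin p → ℝ) =>
      (if o.2.2.1 = z then (1 : ℝ) else 0) * (if o.2.1 then (1 : ℝ) else 0)) P :=
    .of_bound hZRm.aestronglyMeasurable 1 (ae_of_all _ hZRbd)
  have hlamTm : Measurable (fun o : (Fin d → ℝ) × Bool × 𝒵 × (Fin p → ℝ) =>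
    lam (o.1, o.2.2.2)) := hlamm.comp hTm
  have hpiTm : Measurable (fun o : (Fin d → ℝ) × Bool × 𝒵 × (Fin p → ℝ) =>
    pi (o.1, o.2.2.2)) := hpim.comp hTm
  have hgamXm : Measurable (fun o : (Fin d → ℝ) × Bool × 𝒵 × (Fin p → ℝ) => gam o.1) :=
    hgamm.comp hXm
  have hlamb : ∀ᵐ o ∂P, ‖lam (o.1, o.2.2.2)‖ ≤ 1 := by
    have hnn := condExp_nonneg (μ := P)
      (m := MeasurableSpace.comap (fun o => (o.1, o.2.2.2)) inferInstance)
      (f := fun o : (Fin d → ℝ) × Bool × 𝒵 × (Fin p → ℝ) =>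
        (if o.2.2.1 = z then (1 : ℝ) else 0) * (if o.2.1 then (1 : ℝ) else 0))
      (ae_of_all _ fun o => by dsimp only; split_ifs <;> simp)
    have hle := condExp_mono (m := MeasurableSpace.comap (fun o => (o.1, o.2.2.2)) inferInstance)
      hZRint hRint (ae_of_all _ fun o => by dsimp only; split_ifs <;> simp)
    filter_upwards [hnn, hle, hpi, hlam, hpib] with o h0 h1 hp hl hb
    have hpos : 0 < pi (o.1, o.2.2.2) := hε.trans hb.1
    rw [← hl] at h0 h1
    rw [← hp] at h1
    rw [Real.norm_eq_abs, abs_of_nonneg (nonneg_of_mul_nonneg_left h0 hpos)]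
    exact le_of_mul_le_mul_right (by linarith) hpos
  have hgaminv : ∀ᵐ o ∂P, ‖(gam o.1)⁻¹‖ ≤ ε⁻¹ := by
    filter_upwards [hgamb] with o ho
    rw [norm_inv, Real.norm_of_nonneg (hε.trans ho.1).le]
    exact inv_anti₀ hε ho.1.le
  have hpiinv : ∀ᵐ o ∂P, ‖(pi (o.1, o.2.2.2))⁻¹‖ ≤ ε⁻¹ := by
    filter_upwards [hpib] with o ho
    rw [norm_inv, Real.norm_of_nonneg (hε.trans ho.1).le]
    exact inv_anti₀ hε ho.1.le
  have hlamint : Integrable (fun o => lam (o.1, o.2.2.2)) P :=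
    .of_bound hlamTm.aestronglyMeasurable 1 hlamb
  have hYlam : Integrable (fun o => o.2.2.2 j * lam (o.1, o.2.2.2)) P :=
    (hYint j).mul_bdd hlamTm.aestronglyMeasurable hlamb
  have hbetaint : Integrable (fun o => beta o.1 j) P :=
    integrable_condExp.congr (hbeta j).symm
  have hratio : Integrable (fun o => beta o.1 j / gam o.1) P := by
    simpa only [div_eq_mul_inv, Pi.inv_apply, Pi.sub_apply] using
      hbetaint.mul_bdd hgamXm.inv.aestronglyMeasurable hgaminv
  have hratio2 : Integrable (fun o => beta o.1 j / gam o.1 / gam o.1) P := by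
    simpa only [div_eq_mul_inv, Pi.inv_apply, Pi.sub_apply] using
      hratio.mul_bdd hgamXm.inv.aestronglyMeasurable hgaminv
  have hA : Integrable (fun o => (o.2.2.2 j - beta o.1 j / gam o.1) / gam o.1) P := by
    simpa only [div_eq_mul_inv, Pi.inv_apply, Pi.sub_apply] using
      ((hYint j).sub hratio).mul_bdd hgamXm.inv.aestronglyMeasurable hgaminv
  have hApi : Integrable
      (fun o => (o.2.2.2 j - beta o.1 j / gam o.1) / gam o.1 / pi (o.1, o.2.2.2)) P := by
    simpa only [div_eq_mul_inv, Pi.inv_apply, Pi.sub_apply] using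
      hA.mul_bdd hpiTm.inv.aestronglyMeasurable hpiinv
  have hApilam := hApi.mul_bdd hlamTm.aestronglyMeasurable hlamb
  have hZRterm := hApi.mul_bdd hZRm.aestronglyMeasurable (ae_of_all _ hZRbd)
  have hRterm := hApilam.mul_bdd (c := 1) hRm.aestronglyMeasurable
    (ae_of_all _ fun o => by split_ifs <;> simp)
  have hYterm := hYlam.bdd_mul hgamXm.inv.aestronglyMeasurable hgaminv
  have hlamterm := hratio2.mul_bdd hlamTm.aestronglyMeasurable hlamb
  have hum : Measurable (fun t : (Fin d → ℝ) × (Fin p → ℝ) =>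
      (t.2 j - beta t.1 j / gam t.1) / gam t.1 / pi t) := by fun_prop
  have hvm : Measurable (fun x : Fin d → ℝ => beta x j / gam x / gam x) := by fun_prop
  have eZR := integral_comp_mul_eq_of_ae_eq_condExp hTm hum hZRint hZRterm hlam
  have eR := integral_comp_mul_eq_of_ae_eq_condExp hTm (hum.mul hlamm) hRint hRterm hpi
  have eY := integral_comp_mul_eq_of_ae_eq_condExp hXm hgamm.inv hYlam hYterm (hbeta j)
  have elam := integral_comp_mul_eq_of_ae_eq_condExp hXm hvm hlamint hlamterm hgam
  have hcancelR := eZR.trans ((integral_congr_ae (ae_of_all _ fun o => by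
    simp only [Pi.mul_apply]; ring)).trans eR.symm)
  have hcancelY := eY.trans ((integral_congr_ae (by
    filter_upwards [hgamb] with o ho
    have hne : gam o.1 ≠ 0 := (hε.trans ho.1).ne'
    simp only [Pi.inv_apply]
    field_simp)).trans elam.symm)
  have hRzero := (integral_sub hZRterm hRterm).trans (sub_eq_zero.2 hcancelR)
  have hYzero := (integral_sub hYterm hlamterm).trans (sub_eq_zero.2 hcancelY)
  have hsum := integral_add ((hZRterm.sub hRterm).add (hYterm.sub hlamterm)) hratio
  have hsum0 := integral_add (hZRterm.sub hRterm) (hYterm.sub hlamterm)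
  have hzero := hsum0.trans (by
    simp only [Pi.sub_apply]
    exact (congrArg₂ (· + ·) hRzero hYzero).trans (add_zero 0))
  refine (integral_congr_ae (ae_of_all _ fun o => ?_)).trans
    (hsum.trans ((congrArg (· + _) hzero).trans (zero_add _)))
  simp only [phiFn, Pi.add_apply, Pi.sub_apply, Pi.mul_apply, Pi.inv_apply]
  ring
end

section
/- (Second-order bound on the von Mises remainder.) Suppose ‖Y‖ ≤ M almost surely under P, the true nuisances satisfy γ_z(X) ≥ ε and 0 ≤ π, λ_z ≤ 1, and the fixed measurable functions π̄, λ̄_z, β̄_z, γ̄_z satisfy ε ≤ π̄ ≤ 1−ε, ε ≤ γ̄_z ≤ 1, 0 ≤ λ̄_z ≤ 1 and ‖β̄_z‖ ≤ M pointwise. Then there is a constant C depending only on ε and M such that each component j ∈ {1,…,p} of the remainder satisfies |R_z^j(P̄,P)| ≤ C·( ‖π̄ − π‖·‖λ̄_z − λ_z‖ + ( ‖β̄_z^j − β_z^j‖ + ‖γ̄_z − γ_z‖ )·‖γ̄_z − γ_z‖ ), where ‖f‖ = (∫ f(X,Y)² dP)^{1/2} denotes the L²(P) norm of the corresponding composed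 random variable. -/
open MeasureTheory ProbabilityTheory MeasurableSpace

/-- Cauchy–Schwarz inequality for square-integrable real functions. -/
theorem integral_abs_mul_abs_le_sqrt_mul_sqrt {Ω : Type*} [MeasurableSpace Ω] {P : Measure Ω}
    {f g : Ω → ℝ} (hf : MemLp f 2 P) (hg : MemLp g 2 P) :
    ∫ o, |f o| * |g o| ∂P ≤ Real.sqrt (∫ o, f o ^ 2 ∂P) * Real.sqrt (∫ o, g o ^ 2 ∂P) := by
  have h := integral_mul_norm_le_Lp_mul_Lq (μ := P) (f := f) (g := g)
    Real.HolderConjugate.two_two (by simpa using hf) (by simpa using hg)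
  simpa [Real.sqrt_eq_rpow] using h

/-- A pointwise bound by products of square-integrable errors integrates to a bound by products of
their `L²` norms. -/
theorem abs_integral_le_of_abs_le_mul_errors {Ω : Type*} [MeasurableSpace Ω] {P : Measure Ω}
    {f a b c e : Ω → ℝ} {C : ℝ} (hC : 0 ≤ C)
    (ha : MemLp a 2 P) (hb : MemLp b 2 P) (hc : MemLp c 2 P) (he : MemLp e 2 P)
    (hf : ∀ᵐ o ∂P, |f o| ≤ C * (|a o| * |b o| + (|c o| + |e o|) * |e o|)) :
    |∫ o, f o ∂P| ≤ C *
      (Real.sqrt (∫ o, a o ^ 2 ∂P) * Real.sqrt (∫ o, b o ^ 2 ∂P)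
        + (Real.sqrt (∫ o, c o ^ 2 ∂P) + Real.sqrt (∫ o, e o ^ 2 ∂P)) *
          Real.sqrt (∫ o, e o ^ 2 ∂P)) := by
  have hab : Integrable (fun o => |a o| * |b o|) P := ha.abs.integrable_mul hb.abs
  have hce : Integrable (fun o => |c o| * |e o|) P := hc.abs.integrable_mul he.abs
  have hee : Integrable (fun o => |e o| * |e o|) P := he.abs.integrable_mul he.abs
  simp only [add_mul] at hf ⊢
  have hsum : Integrable (fun o => |c o| * |e o| + |e o| * |e o|) P := hce.add hee
  have hbound : Integrable
      (fun o => C * (|a o| * |b o| + (|c o| * |e o| + |e o| * |e o|))) P :=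
    (hab.add hsum).const_mul C
  refine (norm_integral_le_of_norm_le (f := f) hbound hf).trans ?_
  rw [integral_const_mul, integral_add hab hsum, integral_add hce hee]
  refine mul_le_mul_of_nonneg_left ?_ hC
  exact add_le_add (integral_abs_mul_abs_le_sqrt_mul_sqrt ha hb)
    (add_le_add (integral_abs_mul_abs_le_sqrt_mul_sqrt hc he)
      (integral_abs_mul_abs_le_sqrt_mul_sqrt he he))

/-- The integrand of the remainder is bounded by products of nuisance errors. -/
theorem abs_remainder_integrand_le {ε M y pi pib lam lamb beta betab gam gamb : ℝ}
    (hε : 0 < ε) (hM : 0 < M) (hy : |y| ≤ M) (hbetab : |betab| ≤ M)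
    (hgam : ε ≤ gam) (hgamb : ε ≤ gamb) (hpib : ε ≤ pib) :
    |((y - betab / gamb) / gamb) * ((pi - pib) / pib) * (lam - lamb)
        + ((beta - betab) / gam + (betab / gamb) * ((gamb - gam) / gam)) * ((gam - gamb) / gamb)|
      ≤ ((M + M / ε) / ε / ε + 1 / ε / ε + M / ε / ε / ε) *
        (|pib - pi| * |lamb - lam| + (|betab - beta| + |gamb - gam|) * |gamb - gam|) := by
  have div_le {u v U : ℝ} (hu : |u| ≤ U) (hv : ε ≤ v) : |u / v| ≤ U / ε := by
    rw [abs_div, abs_of_pos (hε.trans_le hv)]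
    exact div_le_div₀ ((abs_nonneg u).trans hu) hu hε hv
  have hratio : |betab / gamb| ≤ M / ε := div_le hbetab hgamb
  have hresid : |(y - betab / gamb) / gamb| ≤ (M + M / ε) / ε :=
    div_le ((abs_sub _ _).trans (add_le_add hy hratio)) hgamb
  have hpi : |(pi - pib) / pib| ≤ |pib - pi| / ε := div_le (abs_sub_comm _ _).le hpib
  have hbeta : |(beta - betab) / gam| ≤ |betab - beta| / ε := div_le (abs_sub_comm _ _).le hgam
  have hgam₁ : |(gamb - gam) / gam| ≤ |gamb - gam| / ε := div_le le_rfl hgam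
  have hgam₂ : |(gam - gamb) / gamb| ≤ |gamb - gam| / ε := div_le (abs_sub_comm _ _).le hgamb
  have hfirst : |((y - betab / gamb) / gamb) * ((pi - pib) / pib) * (lam - lamb)|
      ≤ (M + M / ε) / ε * (|pib - pi| / ε) * |lamb - lam| := by
    rw [abs_mul, abs_mul, abs_sub_comm lam]
    gcongr
  have hsecond :
      |((beta - betab) / gam + (betab / gamb) * ((gamb - gam) / gam)) * ((gam - gamb) / gamb)|
      ≤ (|betab - beta| / ε + M / ε * (|gamb - gam| / ε)) * (|gamb - gam| / ε) := by
    rw [abs_mul]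
    gcongr
    refine (abs_add_le _ _).trans (add_le_add hbeta ?_)
    rw [abs_mul]
    gcongr
  refine (abs_add_le _ _).trans ((add_le_add hfirst hsecond).trans ?_)
  have h₁ : 0 ≤ (M + M / ε) / ε / ε := by positivity
  have h₂ : 0 ≤ 1 / ε / ε := by positivity
  have h₃ : 0 ≤ M / ε / ε / ε := by positivity
  have hab : 0 ≤ |pib - pi| * |lamb - lam| := by positivity
  have hce : 0 ≤ |betab - beta| * |gamb - gam| := by positivity
  have hee : 0 ≤ |gamb - gam| * |gamb - gam| := by positivity
  have hsplit : (M + M / ε) / ε * (|pib - pi| / ε) * |lamb - lam|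
      + (|betab - beta| / ε + M / ε * (|gamb - gam| / ε)) * (|gamb - gam| / ε)
      = (M + M / ε) / ε / ε * (|pib - pi| * |lamb - lam|)
        + 1 / ε / ε * (|betab - beta| * |gamb - gam|)
        + M / ε / ε / ε * (|gamb - gam| * |gamb - gam|) := by ring
  rw [hsplit, add_mul |betab - beta|]
  generalize (M + M / ε) / ε / ε = K₁ at *
  generalize 1 / ε / ε = K₂ at *
  generalize M / ε / ε / ε = K₃ at *
  have := mul_nonneg h₁ hce
  have := mul_nonneg h₁ hee
  have := mul_nonneg h₂ hab
  have := mul_nonneg h₂ hee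
  have := mul_nonneg h₃ hab
  have := mul_nonneg h₃ hce
  linarith

/-- **Second-order bound on the von Mises remainder.**
If `‖Y‖ ≤ M` a.s. under `P`, the true nuisances satisfy `γ_z ≥ ε` and `0 ≤ π, λ_z ≤ 1`,
and the fixed measurable functions `π̄, λ̄_z, β̄_z, γ̄_z` satisfy `ε ≤ π̄ ≤ 1−ε`,
`ε ≤ γ̄_z ≤ 1`, `0 ≤ λ̄_z ≤ 1` and `‖β̄_z‖ ≤ M` pointwise, then there is a constant `C`
depending only on `ε` and `M` such that each component `j` of the remainder satisfies
`|R_z^j(P̄,P)| ≤ C (‖π̄−π‖ ‖λ̄_z−λ_z‖ + (‖β̄_z^j−β_z^j‖ + ‖γ̄_z−γ_z‖) ‖γ̄_z−γ_z‖)`,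
with `‖·‖` the `L²(P)` norm of the composed random variable. -/
theorem remainder_second_order_bound (ε M : ℝ) (hε : 0 < ε) (hM : 0 < M) :
    ∃ C : ℝ, ∀ (d p : ℕ) (𝒵 : Type) [MeasurableSpace 𝒵] [MeasurableSingletonClass 𝒵]
      [Finite 𝒵] [DecidableEq 𝒵] (z : 𝒵)
      (P : Measure ((Fin d → ℝ) × Bool × 𝒵 × (Fin p → ℝ))) (_ : IsProbabilityMeasure P)
      -- Y is bounded by M
      (_ : ∀ᵐ o ∂P, ‖o.2.2.2‖ ≤ M)
      -- true nuisance functions and their defining properties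
      (pi lam : (Fin d → ℝ) × (Fin p → ℝ) → ℝ) (_ : Measurable pi) (_ : Measurable lam)
      (_ : (fun o => pi (o.1, o.2.2.2)) =ᵐ[P]
        P[fun o => if o.2.1 then (1 : ℝ) else 0 |
          MeasurableSpace.comap (fun o => (o.1, o.2.2.2)) inferInstance])
      (_ : (fun o => lam (o.1, o.2.2.2) * pi (o.1, o.2.2.2)) =ᵐ[P]
        P[fun o => (if o.2.2.1 = z then (1 : ℝ) else 0) * (if o.2.1 then (1 : ℝ) else 0) |
          MeasurableSpace.comap (fun o => (o.1, o.2.2.2)) inferInstance])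
      (beta : (Fin d → ℝ) → (Fin p → ℝ)) (_ : Measurable beta)
      (_ : ∀ j : Fin p, (fun o => beta o.1 j) =ᵐ[P]
        P[fun o => o.2.2.2 j * lam (o.1, o.2.2.2) |
          MeasurableSpace.comap Prod.fst inferInstance])
      (gam : (Fin d → ℝ) → ℝ) (_ : Measurable gam)
      (_ : (fun o => gam o.1) =ᵐ[P]
        P[fun o => lam (o.1, o.2.2.2) | MeasurableSpace.comap Prod.fst inferInstance])
      -- bounds on the true nuisances
      (_ : ∀ᵐ o ∂P, ε ≤ gam o.1)
      (_ : ∀ᵐ o ∂P, 0 ≤ pi (o.1, o.2.2.2) ∧ pi (o.1, o.2.2.2) ≤ 1)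
      (_ : ∀ᵐ o ∂P, 0 ≤ lam (o.1, o.2.2.2) ∧ lam (o.1, o.2.2.2) ≤ 1)
      -- fixed "barred" measurable functions with pointwise bounds
      (pib lamb : (Fin d → ℝ) × (Fin p → ℝ) → ℝ) (_ : Measurable pib) (_ : Measurable lamb)
      (betab : (Fin d → ℝ) → (Fin p → ℝ)) (_ : Measurable betab)
      (gamb : (Fin d → ℝ) → ℝ) (_ : Measurable gamb)
      (_ : ∀ v, ε ≤ pib v ∧ pib v ≤ 1 - ε)
      (_ : ∀ v, 0 ≤ lamb v ∧ lamb v ≤ 1)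
      (_ : ∀ x, ε ≤ gamb x ∧ gamb x ≤ 1)
      (_ : ∀ x, ‖betab x‖ ≤ M)
      -- the remainder
      (Rem : Fin p → ℝ)
      (_ : ∀ j, Rem j = ∫ o,
        (((o.2.2.2 j - betab o.1 j / gamb o.1) / gamb o.1) *
            ((pi (o.1, o.2.2.2) - pib (o.1, o.2.2.2)) / pib (o.1, o.2.2.2)) *
            (lam (o.1, o.2.2.2) - lamb (o.1, o.2.2.2))
          + ((beta o.1 j - betab o.1 j) / gam o.1
              + (betab o.1 j / gamb o.1) * ((gamb o.1 - gam o.1) / gam o.1)) *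
            ((gam o.1 - gamb o.1) / gamb o.1)) ∂P)
      (j : Fin p),
      |Rem j| ≤ C *
        (Real.sqrt (∫ o, (pib (o.1, o.2.2.2) - pi (o.1, o.2.2.2)) ^ 2 ∂P) *
            Real.sqrt (∫ o, (lamb (o.1, o.2.2.2) - lam (o.1, o.2.2.2)) ^ 2 ∂P)
          + (Real.sqrt (∫ o, (betab o.1 j - beta o.1 j) ^ 2 ∂P)
              + Real.sqrt (∫ o, (gamb o.1 - gam o.1) ^ 2 ∂P)) *
            Real.sqrt (∫ o, (gamb o.1 - gam o.1) ^ 2 ∂P)) := by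
  refine ⟨(M + M / ε) / ε / ε + 1 / ε / ε + M / ε / ε / ε, ?_⟩
  intro d p 𝒵 _ _ _ _ z P hP hY pi lam hpi_meas hlam_meas _ _ beta hbeta_meas hbeta gam hgam_meas
    hgam hgam_ge hpi_mem hlam_mem pib lamb hpib_meas hlamb_meas betab hbetab_meas gamb hgamb_meas
    hpib hlamb hgamb hbetab Rem hRem j
  have hYj : ∀ᵐ o ∂P, |o.2.2.2 j| ≤ M := by
    filter_upwards [hY] with o ho using (norm_le_pi_norm o.2.2.2 j).trans ho
  have hbetabj (x : Fin d → ℝ) : |betab x j| ≤ M := (norm_le_pi_norm (betab x) j).trans (hbetab x)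
  have hgam_le : ∀ᵐ o ∂P, |gam o.1| ≤ 1 := by
    have h := ae_bdd_abs_condExp_of_ae_bdd_abs (m := MeasurableSpace.comap Prod.fst inferInstance)
      (R := 1) (f := fun o => lam (o.1, o.2.2.2)) (μ := P) (by
        filter_upwards [hlam_mem] with o ho
        simpa [abs_of_nonneg ho.1] using ho.2)
    filter_upwards [h, hgam] with o ho hgo
    simpa [hgo] using ho
  have hbeta_le : ∀ᵐ o ∂P, |beta o.1 j| ≤ M := by
    have h := ae_bdd_abs_condExp_of_ae_bdd_abs (m := MeasurableSpace.comap Prod.fst inferInstance)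
      (R := M) (f := fun o => o.2.2.2 j * lam (o.1, o.2.2.2)) (μ := P) (by
        filter_upwards [hlam_mem, hYj] with o ho hyo
        rw [abs_mul, abs_of_nonneg ho.1]
        exact (mul_le_of_le_one_right (abs_nonneg _) ho.2).trans hyo)
    filter_upwards [h, hbeta j] with o ho hbo
    rw [hbo]
    exact ho
  rw [hRem j]
  apply abs_integral_le_of_abs_le_mul_errors (by positivity)
  · refine MemLp.of_bound (by fun_prop) 1 ?_
    filter_upwards [hpi_mem] with o ho
    have := hpib (o.1, o.2.2.2)
    rw [Real.norm_eq_abs, abs_le]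
    constructor <;> linarith
  · refine MemLp.of_bound (by fun_prop) 1 ?_
    filter_upwards [hlam_mem] with o ho
    have := hlamb (o.1, o.2.2.2)
    rw [Real.norm_eq_abs, abs_le]
    constructor <;> linarith
  · refine MemLp.of_bound (by fun_prop) (M + M) ?_
    filter_upwards [hbeta_le] with o ho
    exact (abs_sub _ _).trans (add_le_add (hbetabj o.1) ho)
  · refine MemLp.of_bound (by fun_prop) (1 + 1) ?_
    filter_upwards [hgam_le] with o ho
    refine (abs_sub _ _).trans (add_le_add ?_ ho)
    rw [abs_of_pos (hε.trans_le (hgamb o.1).1)]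
    exact (hgamb o.1).2
  · filter_upwards [hYj, hgam_ge] with o hyo hgo
    exact abs_remainder_integrand_le hε hM hyo (hbetabj o.1) hgo (hgamb o.1).1
      (hpib (o.1, o.2.2.2)).1
end
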